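/- Let T ⊆ B(H,K) be a TRO and X ⊆ T a sub-TRO. Then X is nondegenerate in T (i.e. ⟨X T* T⟩ = T and ⟨T T* X⟩ = T) if and only if A_X is a nondegenerate C*-subalgebra of A_T, i.e. the norm-closed linear span of {b a : b ∈ A_X, a ∈ A_T} equals A_T and the norm-closed linear span of {a b : a ∈ A_T, b ∈ A_X} equals A_T. -/

import Mathlib

noncomputable section

open ContinuousLinearMap

/-- The closed linear span of a set in a complex normed space. -/
def cspan {V : Type*} [NormedAddCommGroup V] [NormedSpace ℂ V] (S : Set V) : Set V :=
  closure (Submodule.span ℂ S : Set V)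

variable {H K : Type*} [NormedAddCommGroup H] [InnerProductSpace ℂ H] [CompleteSpace H]
  [NormedAddCommGroup K] [InnerProductSpace ℂ K] [CompleteSpace K]

/-- The ternary product `a b* c` of operators in `B(H,K)`. -/
def tp (a b c : H →L[ℂ] K) : H →L[ℂ] K :=
  a ∘L ((ContinuousLinearMap.adjoint b) ∘L c)

/-- A TRO: a norm-closed linear subspace of `B(H,K)` stable under `(a,b,c) ↦ a b* c`. -/
def IsTRO (T : Set (H →L[ℂ] K)) : Prop :=
  IsClosed T ∧ (∃ S : Submodule ℂ (H →L[ℂ] K), T = ↑S) ∧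
    ∀ a ∈ T, ∀ b ∈ T, ∀ c ∈ T, tp a b c ∈ T

/-- A sub-TRO of `T`: a norm-closed linear subspace of `T` stable under the ternary product. -/
def IsSubTRO (T X : Set (H →L[ℂ] K)) : Prop :=
  X ⊆ T ∧ IsClosed X ∧ (∃ S : Submodule ℂ (H →L[ℂ] K), X = ↑S) ∧
    ∀ a ∈ X, ∀ b ∈ X, ∀ c ∈ X, tp a b c ∈ X

/-- The set `{a b* : a ∈ T₁, b ∈ T₂} ⊆ B(K)`. -/
def setMulStar (T₁ T₂ : Set (H →L[ℂ] K)) : Set (K →L[ℂ] K) :=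
  {w | ∃ a ∈ T₁, ∃ b ∈ T₂, w = a ∘L ContinuousLinearMap.adjoint b}

/-- The set `{a* b : a ∈ T₁, b ∈ T₂} ⊆ B(H)`. -/
def setStarMul (T₁ T₂ : Set (H →L[ℂ] K)) : Set (H →L[ℂ] H) :=
  {w | ∃ a ∈ T₁, ∃ b ∈ T₂, w = ContinuousLinearMap.adjoint a ∘L b}

/-- Nondegeneracy of a sub-TRO `X ⊆ T`: `⟨X T* T⟩ = T` and `⟨T T* X⟩ = T`. -/
def Nondegenerate (T X : Set (H →L[ℂ] K)) : Prop :=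
  cspan {w | ∃ x ∈ X, ∃ a ∈ T, ∃ b ∈ T, w = tp x a b} = T ∧
  cspan {w | ∃ a ∈ T, ∃ b ∈ T, ∃ x ∈ X, w = tp a b x} = T

/-- A TRO conditional expectation from `T` onto the sub-TRO `X`: a linear idempotent
surjection `P : T → X` (formalised as a map of the ambient space which is linear on `T`,
maps `T` into `X` and fixes `X`) satisfying the three module identities. -/
def IsTROCondExp (T X : Set (H →L[ℂ] K)) (P : (H →L[ℂ] K) → (H →L[ℂ] K)) : Prop :=
  (∀ s ∈ T, ∀ t ∈ T, P (s + t) = P s + P t) ∧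
  (∀ (z : ℂ), ∀ t ∈ T, P (z • t) = z • P t) ∧
  (∀ t ∈ T, P t ∈ X) ∧ (∀ x ∈ X, P x = x) ∧
  (∀ a ∈ T, ∀ x ∈ X, ∀ y ∈ X, P (tp a x y) = tp (P a) x y) ∧
  (∀ a ∈ T, ∀ x ∈ X, ∀ y ∈ X, P (tp x a y) = tp x (P a) y) ∧
  (∀ a ∈ T, ∀ x ∈ X, ∀ y ∈ X, P (tp x y a) = tp x y (P a))

/-- `P` is contractive on the set `S`. -/
def ContractiveOn {V W : Type*} [Norm V] [Norm W] (S : Set V) (P : V → W) : Prop :=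
  ∀ v ∈ S, ‖P v‖ ≤ ‖v‖

/-- The block operator `[[c, t], [s, d]]` on the Hilbert space direct sum `K ⊕ H`. -/
def blockOp (c : K →L[ℂ] K) (t : H →L[ℂ] K) (s : K →L[ℂ] H) (d : H →L[ℂ] H) :
    WithLp 2 (K × H) →L[ℂ] WithLp 2 (K × H) :=
  ((WithLp.prodContinuousLinearEquiv 2 ℂ K H).symm :
      (K × H) →L[ℂ] WithLp 2 (K × H)) ∘L
    ((c ∘L ContinuousLinearMap.fst ℂ K H + t ∘L ContinuousLinearMap.snd ℂ K H).prod
      (s ∘L ContinuousLinearMap.fst ℂ K H + d ∘L ContinuousLinearMap.snd ℂ K H)) ∘L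
    ((WithLp.prodContinuousLinearEquiv 2 ℂ K H : WithLp 2 (K × H) →L[ℂ] K × H))

/-- The linking algebra `A_T ⊆ B(K ⊕ H)` of a TRO `T`, consisting of the block operators
`[[c, t], [s*, d]]` with `c ∈ ⟨T T*⟩`, `t, s ∈ T`, `d ∈ ⟨T* T⟩`. -/
def linkingAlgebra (T : Set (H →L[ℂ] K)) :
    Set (WithLp 2 (K × H) →L[ℂ] WithLp 2 (K × H)) :=
  {w | ∃ c ∈ cspan (setMulStar T T), ∃ t ∈ T, ∃ s ∈ T, ∃ d ∈ cspan (setStarMul T T),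
    w = blockOp c t (ContinuousLinearMap.adjoint s) d}

/-- The corner copy `[[0, t], [0, 0]]` of `t ∈ T` inside the linking algebra. -/
def cornerOp (t : H →L[ℂ] K) : WithLp 2 (K × H) →L[ℂ] WithLp 2 (K × H) :=
  blockOp 0 t 0 0

/-- A conditional expectation from a C*-algebra of operators `A` onto a subalgebra `B`
(formalised as a map of the ambient operator algebra which is linear and contractive
on `A`, maps `A` into `B`, fixes `B` and is a `B`-bimodule map on `A`). -/
def IsCondExp {L : Type*} [NormedAddCommGroup L] [InnerProductSpace ℂ L] [CompleteSpace L]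
    (A B : Set (L →L[ℂ] L)) (E : (L →L[ℂ] L) → (L →L[ℂ] L)) : Prop :=
  (∀ a ∈ A, ∀ b ∈ A, E (a + b) = E a + E b) ∧
  (∀ (z : ℂ), ∀ a ∈ A, E (z • a) = z • E a) ∧
  (∀ a ∈ A, ‖E a‖ ≤ ‖a‖) ∧
  (∀ a ∈ A, E a ∈ B) ∧ (∀ b ∈ B, E b = b) ∧
  (∀ a ∈ A, ∀ b ∈ B, E (a ∘L b) = E a ∘L b ∧ E (b ∘L a) = b ∘L E a)

section ClosedSpan

variable {V W : Type*} [NormedAddCommGroup V] [NormedSpace ℂ V]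
  [NormedAddCommGroup W] [NormedSpace ℂ W]

lemma isClosed_cspan (S : Set V) : IsClosed (cspan S) := isClosed_closure

lemma subset_cspan (S : Set V) : S ⊆ cspan S :=
  Submodule.subset_span.trans subset_closure

lemma cspan_mono {S S' : Set V} (h : S ⊆ S') : cspan S ⊆ cspan S' :=
  closure_mono (Submodule.span_mono h)

lemma zero_mem_cspan (S : Set V) : (0 : V) ∈ cspan S :=
  (Submodule.span ℂ S).topologicalClosure.zero_mem

lemma add_mem_cspan {S : Set V} {v w : V} (hv : v ∈ cspan S) (hw : w ∈ cspan S) :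
    v + w ∈ cspan S :=
  (Submodule.span ℂ S).topologicalClosure.add_mem hv hw

/-- A continuous semilinear map sending `S` into a closed subspace `M` sends the closed span
of `S` into `M`. -/
lemma map_mem_of_mem_cspan {σ : ℂ →+* ℂ} (f : V →SL[σ] W) {S : Set V} {M : Submodule ℂ W}
    (hM : IsClosed (M : Set W)) (h : ∀ s ∈ S, f s ∈ M) {v : V} (hv : v ∈ cspan S) : f v ∈ M := by
  have h₁ : Submodule.span ℂ S ≤ M.comap (f : V →ₛₗ[σ] W) := Submodule.span_le.2 h
  exact closure_minimal (t := f ⁻¹' (M : Set W)) h₁ (hM.preimage f.continuous) hv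

lemma map_mem_cspan {σ : ℂ →+* ℂ} (f : V →SL[σ] W) {S : Set V} {S' : Set W}
    (h : ∀ s ∈ S, f s ∈ cspan S') {v : V} (hv : v ∈ cspan S) : f v ∈ cspan S' :=
  map_mem_of_mem_cspan f (M := (Submodule.span ℂ S').topologicalClosure)
    (isClosed_cspan S') h hv

lemma cspan_subset {S : Set V} {M : Submodule ℂ V} (hM : IsClosed (M : Set V))
    (h : S ⊆ M) : cspan S ⊆ M :=
  fun _ hv => map_mem_of_mem_cspan (ContinuousLinearMap.id ℂ V) hM h hv

end ClosedSpan

section Adjoint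

variable {E F : Type*} [NormedAddCommGroup E] [InnerProductSpace ℂ E] [CompleteSpace E]
  [NormedAddCommGroup F] [InnerProductSpace ℂ F] [CompleteSpace F]

/-- The adjoint as a continuous conjugate-linear map. -/
def adjointCLM : (E →L[ℂ] F) →L⋆[ℂ] (F →L[ℂ] E) :=
  (ContinuousLinearMap.adjoint (𝕜 := ℂ) (E := E) (F := F)).toContinuousLinearEquiv

@[simp] lemma adjointCLM_apply (a : E →L[ℂ] F) :
    adjointCLM a = ContinuousLinearMap.adjoint a := rfl

end Adjoint

section Block

variable {H K : Type*} [NormedAddCommGroup H] [InnerProductSpace ℂ H]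
  [NormedAddCommGroup K] [InnerProductSpace ℂ K]

lemma blockOp_comp (c c' : K →L[ℂ] K) (t t' : H →L[ℂ] K) (s s' : K →L[ℂ] H)
    (d d' : H →L[ℂ] H) :
    blockOp c t s d ∘L blockOp c' t' s' d' =
      blockOp (c ∘L c' + t ∘L s') (c ∘L t' + t ∘L d')
        (s ∘L c' + d ∘L s') (s ∘L t' + d ∘L d') := by
  ext v
  simp only [blockOp, ContinuousLinearMap.comp_apply, ContinuousLinearMap.prod_apply,
    _root_.add_apply, map_add, ContinuousLinearEquiv.coe_coe,
    ContinuousLinearEquiv.apply_symm_apply, ContinuousLinearMap.coe_fst',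
    ContinuousLinearMap.coe_snd']
  congr 2 <;> abel

/-- The inclusion of the first summand of `K ⊕ H`. -/
def inclFst : K →L[ℂ] WithLp 2 (K × H) :=
  ((WithLp.prodContinuousLinearEquiv 2 ℂ K H).symm : (K × H) →L[ℂ] WithLp 2 (K × H)) ∘L
    ContinuousLinearMap.inl ℂ K H

/-- The inclusion of the second summand of `K ⊕ H`. -/
def inclSnd : H →L[ℂ] WithLp 2 (K × H) :=
  ((WithLp.prodContinuousLinearEquiv 2 ℂ K H).symm : (K × H) →L[ℂ] WithLp 2 (K × H)) ∘L
    ContinuousLinearMap.inr ℂ K H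

/-- The projection of `K ⊕ H` onto its first summand. -/
def projFst : WithLp 2 (K × H) →L[ℂ] K :=
  ContinuousLinearMap.fst ℂ K H ∘L
    (WithLp.prodContinuousLinearEquiv 2 ℂ K H : WithLp 2 (K × H) →L[ℂ] K × H)

/-- The projection of `K ⊕ H` onto its second summand. -/
def projSnd : WithLp 2 (K × H) →L[ℂ] H :=
  ContinuousLinearMap.snd ℂ K H ∘L
    (WithLp.prodContinuousLinearEquiv 2 ℂ K H : WithLp 2 (K × H) →L[ℂ] K × H)

/-- The map `w ↦ a w b` on bounded operators. -/
def sandwich {E F G L : Type*} [NormedAddCommGroup E] [NormedSpace ℂ E]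
    [NormedAddCommGroup F] [NormedSpace ℂ F] [NormedAddCommGroup G] [NormedSpace ℂ G]
    [NormedAddCommGroup L] [NormedSpace ℂ L] (a : G →L[ℂ] L) (b : E →L[ℂ] F) :
    (F →L[ℂ] G) →L[ℂ] (E →L[ℂ] L) :=
  (ContinuousLinearMap.compL ℂ E G L a) ∘L ((ContinuousLinearMap.compL ℂ E F G).flip b)

@[simp] lemma sandwich_apply {E F G L : Type*} [NormedAddCommGroup E] [NormedSpace ℂ E]
    [NormedAddCommGroup F] [NormedSpace ℂ F] [NormedAddCommGroup G] [NormedSpace ℂ G]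
    [NormedAddCommGroup L] [NormedSpace ℂ L] (a : G →L[ℂ] L) (b : E →L[ℂ] F)
    (w : F →L[ℂ] G) : sandwich a b w = a ∘L w ∘L b := rfl

/-- The upper left corner of an operator on `K ⊕ H`. -/
def corner₁₁ : (WithLp 2 (K × H) →L[ℂ] WithLp 2 (K × H)) →L[ℂ] (K →L[ℂ] K) :=
  sandwich projFst inclFst

/-- The upper right corner of an operator on `K ⊕ H`. -/
def corner₁₂ : (WithLp 2 (K × H) →L[ℂ] WithLp 2 (K × H)) →L[ℂ] (H →L[ℂ] K) :=
  sandwich projFst inclSnd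

/-- The lower left corner of an operator on `K ⊕ H`. -/
def corner₂₁ : (WithLp 2 (K × H) →L[ℂ] WithLp 2 (K × H)) →L[ℂ] (K →L[ℂ] H) :=
  sandwich projSnd inclFst

/-- The lower right corner of an operator on `K ⊕ H`. -/
def corner₂₂ : (WithLp 2 (K × H) →L[ℂ] WithLp 2 (K × H)) →L[ℂ] (H →L[ℂ] H) :=
  sandwich projSnd inclSnd

variable (c : K →L[ℂ] K) (t : H →L[ℂ] K) (s : K →L[ℂ] H) (d : H →L[ℂ] H)

@[simp] lemma corner₁₁_blockOp : corner₁₁ (blockOp c t s d) = c := by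
  ext; simp [corner₁₁, blockOp, projFst, inclFst]

@[simp] lemma corner₁₂_blockOp : corner₁₂ (blockOp c t s d) = t := by
  ext; simp [corner₁₂, blockOp, projFst, inclSnd]

@[simp] lemma corner₂₁_blockOp : corner₂₁ (blockOp c t s d) = s := by
  ext; simp [corner₂₁, blockOp, projSnd, inclFst]

@[simp] lemma corner₂₂_blockOp : corner₂₂ (blockOp c t s d) = d := by
  ext; simp [corner₂₂, blockOp, projSnd, inclSnd]

lemma blockOp_corners (w : WithLp 2 (K × H) →L[ℂ] WithLp 2 (K × H)) :
    blockOp (corner₁₁ w) (corner₁₂ w) (corner₂₁ w) (corner₂₂ w) = w := by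
  ext v
  have h : v = WithLp.toLp 2 (v.fst, 0) + WithLp.toLp 2 (0, v.snd) := by
    apply WithLp.ofLp_injective
    ext <;> simp
  conv_rhs => rw [h, map_add]
  apply WithLp.ofLp_injective
  ext <;> simp [blockOp, corner₁₁, corner₁₂, corner₂₁, corner₂₂, projFst, projSnd, inclFst,
    inclSnd]

/-- The embedding of operators as the upper left corner. -/
def embed₁₁ : (K →L[ℂ] K) →L[ℂ] (WithLp 2 (K × H) →L[ℂ] WithLp 2 (K × H)) :=
  sandwich inclFst projFst

lemma embed₁₁_apply : embed₁₁ (H := H) (K := K) c = blockOp c 0 0 0 := by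
  ext; simp [embed₁₁, blockOp, inclFst, projFst]

/-- The embedding of operators as the upper right corner. -/
def embed₁₂ : (H →L[ℂ] K) →L[ℂ] (WithLp 2 (K × H) →L[ℂ] WithLp 2 (K × H)) :=
  sandwich inclFst projSnd

lemma embed₁₂_apply : embed₁₂ (H := H) (K := K) t = blockOp 0 t 0 0 := by
  ext; simp [embed₁₂, blockOp, inclFst, projSnd]

/-- The embedding of operators as the lower left corner. -/
def embed₂₁ : (K →L[ℂ] H) →L[ℂ] (WithLp 2 (K × H) →L[ℂ] WithLp 2 (K × H)) :=
  sandwich inclSnd projFst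

lemma embed₂₁_apply : embed₂₁ (H := H) (K := K) s = blockOp 0 0 s 0 := by
  ext; simp [embed₂₁, blockOp, inclSnd, projFst]

/-- The embedding of operators as the lower right corner. -/
def embed₂₂ : (H →L[ℂ] H) →L[ℂ] (WithLp 2 (K × H) →L[ℂ] WithLp 2 (K × H)) :=
  sandwich inclSnd projSnd

lemma embed₂₂_apply : embed₂₂ (H := H) (K := K) d = blockOp 0 0 0 d := by
  ext; simp [embed₂₂, blockOp, inclSnd, projSnd]

lemma blockOp_eq_add :
    blockOp c t s d =
      blockOp c 0 0 0 + blockOp 0 t 0 0 + blockOp 0 0 s 0 + blockOp 0 0 0 d := by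
  ext
  apply WithLp.ofLp_injective
  ext <;> simp [blockOp]

end Block

section LinkingAlgebra

lemma mem_linkingAlgebra_iff {T : Set (H →L[ℂ] K)}
    {w : WithLp 2 (K × H) →L[ℂ] WithLp 2 (K × H)} :
    w ∈ linkingAlgebra T ↔
      corner₁₁ w ∈ cspan (setMulStar T T) ∧ corner₁₂ w ∈ T ∧
        ContinuousLinearMap.adjoint (corner₂₁ w) ∈ T ∧
        corner₂₂ w ∈ cspan (setStarMul T T) := by
  constructor
  · rintro ⟨c, hc, t, ht, s, hs, d, hd, rfl⟩
    simpa using ⟨hc, ht, hs, hd⟩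
  · rintro ⟨hc, ht, hs, hd⟩
    exact ⟨_, hc, _, ht, _, hs, _, hd, by simp [blockOp_corners]⟩

/-- The linking algebra of a subspace, as a subspace. -/
def linkingSubmodule (S : Submodule ℂ (H →L[ℂ] K)) :
    Submodule ℂ (WithLp 2 (K × H) →L[ℂ] WithLp 2 (K × H)) :=
  (Submodule.span ℂ (setMulStar (S : Set (H →L[ℂ] K)) S)).topologicalClosure.comap
      corner₁₁.toLinearMap ⊓
    (S.comap corner₁₂.toLinearMap ⊓
      (S.comap (adjointCLM.comp corner₂₁).toLinearMap ⊓
        (Submodule.span ℂ (setStarMul (S : Set (H →L[ℂ] K)) S)).topologicalClosure.comap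
          corner₂₂.toLinearMap))

lemma coe_linkingSubmodule (S : Submodule ℂ (H →L[ℂ] K)) :
    (linkingSubmodule S : Set (WithLp 2 (K × H) →L[ℂ] WithLp 2 (K × H))) =
      linkingAlgebra (S : Set (H →L[ℂ] K)) := by
  ext w
  rw [mem_linkingAlgebra_iff]
  rfl

lemma isClosed_linkingAlgebra {T : Set (H →L[ℂ] K)} (hT : IsClosed T) :
    IsClosed (linkingAlgebra T) := by
  have h : linkingAlgebra T = corner₁₁ ⁻¹' cspan (setMulStar T T) ∩
      (corner₁₂ ⁻¹' T ∩ ((adjointCLM.comp corner₂₁) ⁻¹' T ∩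
        corner₂₂ ⁻¹' cspan (setStarMul T T))) :=
    Set.ext fun w => mem_linkingAlgebra_iff
  rw [h]
  exact ((isClosed_cspan _).preimage corner₁₁.continuous).inter
    ((hT.preimage corner₁₂.continuous).inter
      ((hT.preimage (adjointCLM.comp corner₂₁).continuous).inter
        ((isClosed_cspan _).preimage corner₂₂.continuous)))

lemma linkingAlgebra_mono {T X : Set (H →L[ℂ] K)} (h : X ⊆ T) :
    linkingAlgebra X ⊆ linkingAlgebra T := by
  rintro w ⟨c, hc, t, ht, s, hs, d, hd, rfl⟩
  refine ⟨c, cspan_mono ?_ hc, t, h ht, s, h hs, d, cspan_mono ?_ hd, rfl⟩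
  · rintro _ ⟨a, ha, b, hb, rfl⟩
    exact ⟨a, h ha, b, h hb, rfl⟩
  · rintro _ ⟨a, ha, b, hb, rfl⟩
    exact ⟨a, h ha, b, h hb, rfl⟩

variable {T : Set (H →L[ℂ] K)}

lemma IsTRO.zero_mem (hT : IsTRO T) : (0 : H →L[ℂ] K) ∈ T := by
  obtain ⟨-, ⟨S, rfl⟩, -⟩ := hT
  exact S.zero_mem

lemma IsTRO.add_mem (hT : IsTRO T) {a b : H →L[ℂ] K} (ha : a ∈ T) (hb : b ∈ T) :
    a + b ∈ T := by
  obtain ⟨-, ⟨S, rfl⟩, -⟩ := hT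
  exact S.add_mem ha hb

lemma IsTRO.map_mem_of_mem_cspan {V : Type*} [NormedAddCommGroup V] [NormedSpace ℂ V]
    (hT : IsTRO T) {σ : ℂ →+* ℂ} (f : V →SL[σ] (H →L[ℂ] K)) {S : Set V}
    (h : ∀ s ∈ S, f s ∈ T) {v : V} (hv : v ∈ cspan S) : f v ∈ T := by
  obtain ⟨hc, ⟨S, rfl⟩, -⟩ := hT
  exact _root_.map_mem_of_mem_cspan f hc h hv

lemma IsTRO.comp_mem_left (hT : IsTRO T) {c : K →L[ℂ] K} (hc : c ∈ cspan (setMulStar T T))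
    {t : H →L[ℂ] K} (ht : t ∈ T) : c ∘L t ∈ T := by
  refine hT.map_mem_of_mem_cspan (sandwich (.id ℂ K) t) ?_ hc
  rintro _ ⟨a, ha, b, hb, rfl⟩
  exact hT.2.2 a ha b hb t ht

lemma IsTRO.comp_mem_right (hT : IsTRO T) {t : H →L[ℂ] K} (ht : t ∈ T) {d : H →L[ℂ] H}
    (hd : d ∈ cspan (setStarMul T T)) : t ∘L d ∈ T := by
  refine hT.map_mem_of_mem_cspan (sandwich t (.id ℂ H)) ?_ hd
  rintro _ ⟨a, ha, b, hb, rfl⟩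
  exact hT.2.2 t ht a ha b hb

lemma adjoint_mem_cspan_setMulStar {c : K →L[ℂ] K} (hc : c ∈ cspan (setMulStar T T)) :
    ContinuousLinearMap.adjoint c ∈ cspan (setMulStar T T) := by
  refine map_mem_cspan adjointCLM ?_ hc
  rintro _ ⟨a, ha, b, hb, rfl⟩
  exact subset_cspan _ ⟨b, hb, a, ha, by simp [ContinuousLinearMap.adjoint_comp]⟩

lemma adjoint_mem_cspan_setStarMul {d : H →L[ℂ] H} (hd : d ∈ cspan (setStarMul T T)) :
    ContinuousLinearMap.adjoint d ∈ cspan (setStarMul T T) := by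
  refine map_mem_cspan adjointCLM ?_ hd
  rintro _ ⟨a, ha, b, hb, rfl⟩
  exact subset_cspan _ ⟨b, hb, a, ha, by simp [ContinuousLinearMap.adjoint_comp]⟩

lemma IsTRO.comp_mem_cspan_setMulStar (hT : IsTRO T) {c c' : K →L[ℂ] K}
    (hc : c ∈ cspan (setMulStar T T)) (hc' : c' ∈ cspan (setMulStar T T)) :
    c ∘L c' ∈ cspan (setMulStar T T) := by
  refine map_mem_cspan (sandwich c (.id ℂ K)) ?_ hc'
  rintro _ ⟨a, ha, b, hb, rfl⟩
  exact subset_cspan _ ⟨c ∘L a, hT.comp_mem_left hc ha, b, hb, rfl⟩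

lemma IsTRO.comp_mem_cspan_setStarMul (hT : IsTRO T) {d d' : H →L[ℂ] H}
    (hd : d ∈ cspan (setStarMul T T)) (hd' : d' ∈ cspan (setStarMul T T)) :
    d ∘L d' ∈ cspan (setStarMul T T) := by
  refine map_mem_cspan (sandwich (.id ℂ H) d') ?_ hd
  rintro _ ⟨a, ha, b, hb, rfl⟩
  exact subset_cspan _ ⟨a, ha, b ∘L d', hT.comp_mem_right hb hd', rfl⟩

lemma IsTRO.comp_mem_linkingAlgebra (hT : IsTRO T)
    {v w : WithLp 2 (K × H) →L[ℂ] WithLp 2 (K × H)}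
    (hv : v ∈ linkingAlgebra T) (hw : w ∈ linkingAlgebra T) : v ∘L w ∈ linkingAlgebra T := by
  obtain ⟨c, hc, t, ht, s, hs, d, hd, rfl⟩ := hv
  obtain ⟨c', hc', t', ht', s', hs', d', hd', rfl⟩ := hw
  refine ⟨_, add_mem_cspan (hT.comp_mem_cspan_setMulStar hc hc')
      (subset_cspan _ ⟨t, ht, s', hs', rfl⟩),
    _, hT.add_mem (hT.comp_mem_left hc ht') (hT.comp_mem_right ht hd'),
    _, hT.add_mem (hT.comp_mem_left (adjoint_mem_cspan_setMulStar hc') hs)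
      (hT.comp_mem_right hs' (adjoint_mem_cspan_setStarMul hd)),
    _, add_mem_cspan (subset_cspan _ ⟨s, hs, t', ht', rfl⟩)
      (hT.comp_mem_cspan_setStarMul hd hd'), ?_⟩
  rw [blockOp_comp]
  simp [ContinuousLinearMap.adjoint_comp]

lemma blockOp₁₁_mem_linkingAlgebra (h0 : (0 : H →L[ℂ] K) ∈ T) {a b : H →L[ℂ] K}
    (ha : a ∈ T) (hb : b ∈ T) :
    blockOp (a ∘L ContinuousLinearMap.adjoint b) 0 0 0 ∈ linkingAlgebra T :=
  ⟨_, subset_cspan _ ⟨a, ha, b, hb, rfl⟩, 0, h0, 0, h0, 0, zero_mem_cspan _, by simp⟩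

lemma blockOp₁₂_mem_linkingAlgebra (h0 : (0 : H →L[ℂ] K) ∈ T) {a : H →L[ℂ] K} (ha : a ∈ T) :
    blockOp 0 a 0 0 ∈ linkingAlgebra T :=
  ⟨0, zero_mem_cspan _, a, ha, 0, h0, 0, zero_mem_cspan _, by simp⟩

lemma blockOp₂₁_mem_linkingAlgebra (h0 : (0 : H →L[ℂ] K) ∈ T) {a : H →L[ℂ] K} (ha : a ∈ T) :
    blockOp 0 0 (ContinuousLinearMap.adjoint a) 0 ∈ linkingAlgebra T :=
  ⟨0, zero_mem_cspan _, 0, h0, a, ha, 0, zero_mem_cspan _, rfl⟩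

lemma blockOp₂₂_mem_linkingAlgebra (h0 : (0 : H →L[ℂ] K) ∈ T) {a b : H →L[ℂ] K}
    (ha : a ∈ T) (hb : b ∈ T) :
    blockOp 0 0 0 (ContinuousLinearMap.adjoint a ∘L b) ∈ linkingAlgebra T :=
  ⟨0, zero_mem_cspan _, 0, h0, 0, h0, _, subset_cspan _ ⟨a, ha, b, hb, rfl⟩, by simp⟩

/-- A closed span contains the linking algebra of `T` once it contains the generators of its
four corners. -/
lemma linkingAlgebra_subset_cspan {P : Set (WithLp 2 (K × H) →L[ℂ] WithLp 2 (K × H))}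
    (h₁₁ : ∀ a ∈ T, ∀ b ∈ T, blockOp (a ∘L ContinuousLinearMap.adjoint b) 0 0 0 ∈ cspan P)
    (h₁₂ : ∀ a ∈ T, blockOp 0 a 0 0 ∈ cspan P)
    (h₂₁ : ∀ a ∈ T, blockOp 0 0 (ContinuousLinearMap.adjoint a) 0 ∈ cspan P)
    (h₂₂ : ∀ a ∈ T, ∀ b ∈ T, blockOp 0 0 0 (ContinuousLinearMap.adjoint a ∘L b) ∈ cspan P) :
    linkingAlgebra T ⊆ cspan P := by
  rintro _ ⟨c, hc, t, ht, s, hs, d, hd, rfl⟩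
  rw [blockOp_eq_add]
  refine add_mem_cspan (add_mem_cspan (add_mem_cspan ?_ (h₁₂ t ht)) (h₂₁ s hs)) ?_
  · rw [← embed₁₁_apply]
    refine map_mem_cspan _ ?_ hc
    rintro _ ⟨a, ha, b, hb, rfl⟩
    rw [embed₁₁_apply]
    exact h₁₁ a ha b hb
  · rw [← embed₂₂_apply]
    refine map_mem_cspan _ ?_ hd
    rintro _ ⟨a, ha, b, hb, rfl⟩
    rw [embed₂₂_apply]
    exact h₂₂ a ha b hb

end LinkingAlgebra

section Nondegenerate

variable {T X : Set (H →L[ℂ] K)}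

lemma IsSubTRO.isTRO (hX : IsSubTRO T X) : IsTRO X := hX.2

lemma IsTRO.cspan_subset (hT : IsTRO T) {S : Set (H →L[ℂ] K)} (h : S ⊆ T) : cspan S ⊆ T :=
  fun _ hv => hT.map_mem_of_mem_cspan (.id ℂ _) h hv

lemma IsTRO.cspan_subset_linkingAlgebra (hT : IsTRO T)
    {P : Set (WithLp 2 (K × H) →L[ℂ] WithLp 2 (K × H))} (h : P ⊆ linkingAlgebra T) :
    cspan P ⊆ linkingAlgebra T := by
  have hclosed := isClosed_linkingAlgebra hT.1
  obtain ⟨-, ⟨S, rfl⟩, -⟩ := hT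
  rw [← coe_linkingSubmodule] at h hclosed ⊢
  exact _root_.cspan_subset hclosed h

/-- If `T = ⟨X T* T⟩ = ⟨T T* X⟩` then `A_T = ⟨A_X A_T⟩`. -/
lemma Nondegenerate.linkingAlgebra_left (hT : IsTRO T) (hX : IsSubTRO T X)
    (h : Nondegenerate T X) :
    cspan {w | ∃ b ∈ linkingAlgebra X, ∃ a ∈ linkingAlgebra T, w = b ∘L a} =
      linkingAlgebra T := by
  obtain ⟨hl, hr⟩ := h
  have hT0 := hT.zero_mem
  have hX0 := hX.isTRO.zero_mem
  apply Set.Subset.antisymm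
  · apply hT.cspan_subset_linkingAlgebra
    rintro _ ⟨b, hb, a, ha, rfl⟩
    exact hT.comp_mem_linkingAlgebra (linkingAlgebra_mono hX.1 hb) ha
  apply linkingAlgebra_subset_cspan
  · intro a ha b hb
    rw [← hl] at ha
    rw [← embed₁₁_apply]
    refine map_mem_cspan (embed₁₁ (H := H) (K := K) ∘L
      (sandwich (.id ℂ K) (ContinuousLinearMap.adjoint b))) ?_ ha
    rintro _ ⟨x, hx, c, hc, d, hd, rfl⟩
    refine subset_cspan _ ⟨_, blockOp₁₂_mem_linkingAlgebra hX0 hx, _,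
      blockOp₂₁_mem_linkingAlgebra hT0 (hT.2.2 b hb d hd c hc), ?_⟩
    rw [ContinuousLinearMap.comp_apply, embed₁₁_apply, blockOp_comp]
    simp [tp, ContinuousLinearMap.adjoint_comp, ContinuousLinearMap.comp_assoc]
  · intro a ha
    rw [← hl] at ha
    rw [← embed₁₂_apply]
    refine map_mem_cspan _ ?_ ha
    rintro _ ⟨x, hx, c, hc, d, hd, rfl⟩
    refine subset_cspan _ ⟨_, blockOp₁₂_mem_linkingAlgebra hX0 hx, _,
      blockOp₂₂_mem_linkingAlgebra hT0 hc hd, ?_⟩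
    rw [embed₁₂_apply, blockOp_comp]
    simp [tp]
  · intro a ha
    rw [← hr] at ha
    rw [← embed₂₁_apply]
    refine map_mem_cspan (embed₂₁.comp (adjointCLM (E := H) (F := K))) ?_ ha
    rintro _ ⟨c, hc, d, hd, x, hx, rfl⟩
    refine subset_cspan _ ⟨_, blockOp₂₁_mem_linkingAlgebra hX0 hx, _,
      blockOp₁₁_mem_linkingAlgebra hT0 hd hc, ?_⟩
    rw [ContinuousLinearMap.comp_apply, embed₂₁_apply, blockOp_comp]
    simp [tp, ContinuousLinearMap.adjoint_comp, ContinuousLinearMap.comp_assoc]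
  · intro a ha b hb
    rw [← hr] at ha
    rw [← embed₂₂_apply]
    refine map_mem_cspan ((embed₂₂ (H := H) (K := K) ∘L
      (sandwich (.id ℂ H) b)).comp (adjointCLM (E := H) (F := K))) ?_ ha
    rintro _ ⟨c, hc, d, hd, x, hx, rfl⟩
    refine subset_cspan _ ⟨_, blockOp₂₁_mem_linkingAlgebra hX0 hx, _,
      blockOp₁₂_mem_linkingAlgebra hT0 (hT.2.2 d hd c hc b hb), ?_⟩
    rw [ContinuousLinearMap.comp_apply, ContinuousLinearMap.comp_apply,
      embed₂₂_apply, blockOp_comp]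
    simp [tp, ContinuousLinearMap.adjoint_comp, ContinuousLinearMap.comp_assoc]

/-- If `T = ⟨X T* T⟩ = ⟨T T* X⟩` then `A_T = ⟨A_T A_X⟩`. -/
lemma Nondegenerate.linkingAlgebra_right (hT : IsTRO T) (hX : IsSubTRO T X)
    (h : Nondegenerate T X) :
    cspan {w | ∃ a ∈ linkingAlgebra T, ∃ b ∈ linkingAlgebra X, w = a ∘L b} =
      linkingAlgebra T := by
  obtain ⟨hl, hr⟩ := h
  have hT0 := hT.zero_mem
  have hX0 := hX.isTRO.zero_mem
  apply Set.Subset.antisymm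
  · apply hT.cspan_subset_linkingAlgebra
    rintro _ ⟨a, ha, b, hb, rfl⟩
    exact hT.comp_mem_linkingAlgebra ha (linkingAlgebra_mono hX.1 hb)
  apply linkingAlgebra_subset_cspan
  · intro a ha b hb
    rw [← hl] at hb
    rw [← embed₁₁_apply]
    refine map_mem_cspan ((embed₁₁ (H := H) (K := K) ∘L
      (sandwich a (.id ℂ K))).comp (adjointCLM (E := H) (F := K))) ?_ hb
    rintro _ ⟨x, hx, c, hc, d, hd, rfl⟩
    refine subset_cspan _ ⟨_, blockOp₁₂_mem_linkingAlgebra hT0 (hT.2.2 a ha d hd c hc), _,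
      blockOp₂₁_mem_linkingAlgebra hX0 hx, ?_⟩
    rw [ContinuousLinearMap.comp_apply, ContinuousLinearMap.comp_apply,
      embed₁₁_apply, blockOp_comp]
    simp [tp, ContinuousLinearMap.adjoint_comp, ContinuousLinearMap.comp_assoc]
  · intro a ha
    rw [← hr] at ha
    rw [← embed₁₂_apply]
    refine map_mem_cspan _ ?_ ha
    rintro _ ⟨c, hc, d, hd, x, hx, rfl⟩
    refine subset_cspan _ ⟨_, blockOp₁₁_mem_linkingAlgebra hT0 hc hd, _,
      blockOp₁₂_mem_linkingAlgebra hX0 hx, ?_⟩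
    rw [embed₁₂_apply, blockOp_comp]
    simp [tp, ContinuousLinearMap.comp_assoc]
  · intro a ha
    rw [← hl] at ha
    rw [← embed₂₁_apply]
    refine map_mem_cspan (embed₂₁.comp (adjointCLM (E := H) (F := K))) ?_ ha
    rintro _ ⟨x, hx, c, hc, d, hd, rfl⟩
    refine subset_cspan _ ⟨_, blockOp₂₂_mem_linkingAlgebra hT0 hd hc, _,
      blockOp₂₁_mem_linkingAlgebra hX0 hx, ?_⟩
    rw [ContinuousLinearMap.comp_apply, embed₂₁_apply, blockOp_comp]
    simp [tp, ContinuousLinearMap.adjoint_comp, ContinuousLinearMap.comp_assoc]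
  · intro a ha b hb
    rw [← hr] at hb
    rw [← embed₂₂_apply]
    refine map_mem_cspan (embed₂₂ (H := H) (K := K) ∘L
      (sandwich (ContinuousLinearMap.adjoint a) (.id ℂ H))) ?_ hb
    rintro _ ⟨c, hc, d, hd, x, hx, rfl⟩
    refine subset_cspan _ ⟨_, blockOp₂₁_mem_linkingAlgebra hT0 (hT.2.2 d hd c hc a ha), _,
      blockOp₁₂_mem_linkingAlgebra hX0 hx, ?_⟩
    rw [ContinuousLinearMap.comp_apply, embed₂₂_apply, blockOp_comp]
    simp [tp, ContinuousLinearMap.adjoint_comp, ContinuousLinearMap.comp_assoc]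

/-- If `A_T = ⟨A_X A_T⟩` then `T = ⟨X T* T⟩`. -/
lemma cspan_left_eq_of_linkingAlgebra (hT : IsTRO T) (hX : IsSubTRO T X)
    (h : cspan {w | ∃ b ∈ linkingAlgebra X, ∃ a ∈ linkingAlgebra T, w = b ∘L a} =
      linkingAlgebra T) :
    cspan {w | ∃ x ∈ X, ∃ a ∈ T, ∃ b ∈ T, w = tp x a b} = T := by
  apply Set.Subset.antisymm
  · apply hT.cspan_subset
    rintro _ ⟨x, hx, a, ha, b, hb, rfl⟩
    exact hT.2.2 x (hX.1 hx) a ha b hb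
  intro t ht
  have hmem := blockOp₁₂_mem_linkingAlgebra hT.zero_mem ht
  rw [← h] at hmem
  rw [← corner₁₂_blockOp 0 t 0 0]
  refine map_mem_cspan corner₁₂ ?_ hmem
  rintro _ ⟨_, ⟨c, hc, x, hx, y, hy, d, hd, rfl⟩, _, ⟨c', hc', u, hu, v, hv, d', hd', rfl⟩, rfl⟩
  rw [blockOp_comp, corner₁₂_blockOp]
  refine add_mem_cspan ?_ ?_
  · refine map_mem_cspan (sandwich (.id ℂ K) u) ?_ hc
    rintro _ ⟨a, ha, b, hb, rfl⟩
    exact subset_cspan _ ⟨a, ha, b, hX.1 hb, u, hu, rfl⟩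
  · refine map_mem_cspan (sandwich x (.id ℂ H)) ?_ hd'
    rintro _ ⟨a, ha, b, hb, rfl⟩
    exact subset_cspan _ ⟨x, hx, a, ha, b, hb, rfl⟩

/-- If `A_T = ⟨A_T A_X⟩` then `T = ⟨T T* X⟩`. -/
lemma cspan_right_eq_of_linkingAlgebra (hT : IsTRO T) (hX : IsSubTRO T X)
    (h : cspan {w | ∃ a ∈ linkingAlgebra T, ∃ b ∈ linkingAlgebra X, w = a ∘L b} =
      linkingAlgebra T) :
    cspan {w | ∃ a ∈ T, ∃ b ∈ T, ∃ x ∈ X, w = tp a b x} = T := by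
  apply Set.Subset.antisymm
  · apply hT.cspan_subset
    rintro _ ⟨a, ha, b, hb, x, hx, rfl⟩
    exact hT.2.2 a ha b hb x (hX.1 hx)
  intro t ht
  have hmem := blockOp₁₂_mem_linkingAlgebra hT.zero_mem ht
  rw [← h] at hmem
  rw [← corner₁₂_blockOp 0 t 0 0]
  refine map_mem_cspan corner₁₂ ?_ hmem
  rintro _ ⟨_, ⟨c, hc, u, hu, v, hv, d, hd, rfl⟩, _, ⟨c', hc', x, hx, y, hy, d', hd', rfl⟩, rfl⟩
  rw [blockOp_comp, corner₁₂_blockOp]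
  refine add_mem_cspan ?_ ?_
  · refine map_mem_cspan (sandwich (.id ℂ K) x) ?_ hc
    rintro _ ⟨a, ha, b, hb, rfl⟩
    exact subset_cspan _ ⟨a, ha, b, hb, x, hx, rfl⟩
  · refine map_mem_cspan (sandwich u (.id ℂ H)) ?_ hd'
    rintro _ ⟨a, ha, b, hb, rfl⟩
    exact subset_cspan _ ⟨u, hu, a, hX.1 ha, b, hb, rfl⟩

end Nondegenerate

/-- A sub-TRO `X ⊆ T` is nondegenerate if and only if the linking algebra
`A_X` is a nondegenerate C*-subalgebra of `A_T`. -/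
theorem nondegenerate_iff_linkingAlgebra_nondegenerate
    (T X : Set (H →L[ℂ] K)) (hT : IsTRO T) (hX : IsSubTRO T X) :
    Nondegenerate T X ↔
      (cspan {w | ∃ b ∈ linkingAlgebra X, ∃ a ∈ linkingAlgebra T, w = b ∘L a}
          = linkingAlgebra T ∧
       cspan {w | ∃ a ∈ linkingAlgebra T, ∃ b ∈ linkingAlgebra X, w = a ∘L b}
          = linkingAlgebra T) := by
  exact ⟨fun h => ⟨h.linkingAlgebra_left hT hX, h.linkingAlgebra_right hT hX⟩,
    fun h => ⟨cspan_left_eq_of_linkingAlgebra hT hX h.1,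
      cspan_right_eq_of_linkingAlgebra hT hX h.2⟩⟩
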